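/- Suppose the subgroup Λ ⊆ ℤ^(2n+1) has rank at most n−1, and d is a degeneration vector for Λ with d₁ > 0. If the first-order system W₀(Λ,d) is nonempty and finite, then there is a positive integer m such that the degeneration vector m·d is genuine. -/

import Mathlib

open scoped BigOperators

/-- The ambient lattice `ℤ^(2n+1)`, with elements written `(a, b, c)`. -/
abbrev GlueVec (n : ℕ) := (Fin n → ℤ) × (Fin n → ℤ) × ℤ

/-- The variety of gluing equation type `V(Λ)`: points `z ∈ (ℂ∖{0,1})^n` with
`∏ zᵢ^{aᵢ} · ∏ (1-zᵢ)^{bᵢ} = (-1)^c` for all `(a,b,c) ∈ Λ`. -/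
def glueVariety (n : ℕ) (Λ : Submodule ℤ (GlueVec n)) : Set (Fin n → ℂ) :=
  {z | (∀ i, z i ≠ 0 ∧ z i ≠ 1) ∧
    ∀ v ∈ Λ, (∏ i, z i ^ v.1 i) * (∏ i, (1 - z i) ^ v.2.1 i) = (-1 : ℂ) ^ v.2.2}

/-- `d` is a degeneration vector for `Λ`: nonzero, nonnegative (automatic as `d : Fin n → ℕ`),
with `∑ aᵢ dᵢ = 0` for all `(a,b,c) ∈ Λ`. -/
def IsDegVec (n : ℕ) (Λ : Submodule ℤ (GlueVec n)) (d : Fin n → ℕ) : Prop :=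
  d ≠ 0 ∧ ∀ v ∈ Λ, ∑ i, v.1 i * (d i : ℤ) = 0

/-- `d` is genuine: there are holomorphic functions `uᵢ` on a disc of radius `ε` about `0`,
with `uᵢ(0) ≠ 0`, and `uᵢ(0) ≠ 1` whenever `dᵢ = 0`, such that
`(t^{d₁}u₁(t), …, t^{dₙ}uₙ(t)) ∈ V(Λ)` for all `0 < |t| < ε`. -/
def IsGenuine (n : ℕ) (Λ : Submodule ℤ (GlueVec n)) (d : Fin n → ℕ) : Prop :=
  ∃ ε : ℝ, 0 < ε ∧ ∃ u : Fin n → (ℂ → ℂ),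
    (∀ i, DifferentiableOn ℂ (u i) (Metric.ball (0 : ℂ) ε)) ∧
    (∀ i, u i 0 ≠ 0) ∧
    (∀ i, d i = 0 → u i 0 ≠ 1) ∧
    ∀ t : ℂ, 0 < ‖t‖ → ‖t‖ < ε → (fun i => t ^ (d i) * u i t) ∈ glueVariety n Λ

/-- The set `Ū = {(t,u) ∈ ℂ × (ℂ∖{0})^n : t^{dᵢ} uᵢ ≠ 1 for all i}`. -/
def Ubar (n : ℕ) (d : Fin n → ℕ) : Set (ℂ × (Fin n → ℂ)) :=
  {p | (∀ i, p.2 i ≠ 0) ∧ ∀ i, p.1 ^ (d i) * p.2 i ≠ 1}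

/-- The set `W(Λ,d) = {(t,u) ∈ Ū : t ≠ 0 and (t^{d₁}u₁, …, t^{dₙ}uₙ) ∈ V(Λ)}`. -/
def Wset (n : ℕ) (Λ : Submodule ℤ (GlueVec n)) (d : Fin n → ℕ) : Set (ℂ × (Fin n → ℂ)) :=
  {p ∈ Ubar n d | p.1 ≠ 0 ∧ (fun i => p.1 ^ (d i) * p.2 i) ∈ glueVariety n Λ}

/-- `W̄(Λ,d)`, the closure of `W(Λ,d)` in `Ū` (with the subspace topology, i.e. the
intersection of the ambient closure with `Ū`). -/
def Wbar (n : ℕ) (Λ : Submodule ℤ (GlueVec n)) (d : Fin n → ℕ) : Set (ℂ × (Fin n → ℂ)) :=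
  closure (Wset n Λ d) ∩ Ubar n d

/-- `W̄₀(Λ,d) = W̄(Λ,d) ∩ {t = 0}`. -/
def WbarZero (n : ℕ) (Λ : Submodule ℤ (GlueVec n)) (d : Fin n → ℕ) : Set (ℂ × (Fin n → ℂ)) :=
  Wbar n Λ d ∩ {p | p.1 = 0}

/-- The first-order system `W₀(Λ,d)`: tuples `(β₂,…,βₙ)` of nonzero complex numbers
(indexed by the indices `i ≠ 1`, i.e. `i ≠ 0` in our `Fin n` numbering), with `βᵢ ≠ 1`
whenever `dᵢ = 0`, satisfying `β₂^{a₂}⋯βₙ^{aₙ} · ∏_{i : dᵢ = 0} (1-βᵢ)^{bᵢ} = (-1)^c`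
for all `(a,b,c) ∈ Λ`. -/
def FirstOrderSys (n : ℕ) (Λ : Submodule ℤ (GlueVec n)) (d : Fin n → ℕ) :
    Set ({i : Fin n // (i : ℕ) ≠ 0} → ℂ) :=
  {β | (∀ i, β i ≠ 0) ∧ (∀ i, d i.1 = 0 → β i ≠ 1) ∧
    ∀ v ∈ Λ, (∏ i, β i ^ v.1 i.1) *
      (∏ i ∈ Finset.univ.filter (fun i : {i : Fin n // (i : ℕ) ≠ 0} => d i.1 = 0),
        (1 - β i) ^ v.2.1 i.1) = (-1 : ℂ) ^ v.2.2}

section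

open Polynomial Filter Topology

theorem Polynomial.evalEval_eq_sum_range {R : Type*} [CommSemiring R] (q : R[X][X]) (x y : R) :
    q.evalEval x y = ∑ i ∈ Finset.range (q.natDegree + 1), (q.coeff i).eval x * y ^ i := by
  rw [evalEval, eval_eq_sum_range (p := q), eval_finsetSum]
  simp

theorem Polynomial.contDiff_evalEval (q : ℂ[X][X]) {n : WithTop ℕ∞} :
    ContDiff ℂ n fun p : ℂ × ℂ => q.evalEval p.1 p.2 := by
  simp_rw [evalEval_eq_sum_range]
  refine ContDiff.sum fun i _ => ContDiff.mul ?_ (contDiff_snd.pow i)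
  have h : ContDiff ℂ n fun x : ℂ => (q.coeff i).eval x := by
    simpa using (q.coeff i).contDiff_aeval (𝕜 := ℂ) (n := n)
  exact h.comp contDiff_fst

theorem Polynomial.continuous_evalEval (q : ℂ[X][X]) :
    Continuous fun p : ℂ × ℂ => q.evalEval p.1 p.2 :=
  (q.contDiff_evalEval (n := 0)).continuous

/-- Near a simple root, `(t, y) ↦ (t, q(t, y))` is a local biholomorphism. -/
theorem Polynomial.exists_openPartialHomeomorph_evalEval (q : ℂ[X][X]) (t y : ℂ)
    (h : q.derivative.evalEval t y ≠ 0) :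
    ∃ Φ : OpenPartialHomeomorph (ℂ × ℂ) (ℂ × ℂ), (t, y) ∈ Φ.source ∧
      (∀ p, Φ p = (p.1, q.evalEval p.1 p.2)) ∧
      DifferentiableAt ℂ Φ.symm (t, q.evalEval t y) := by
  set f : ℂ × ℂ → ℂ := fun p => q.evalEval p.1 p.2 with hf
  have hs : HasStrictFDerivAt f (fderiv ℂ f (t, y)) (t, y) :=
    (q.contDiff_evalEval (n := 1)).contDiffAt.hasStrictFDerivAt one_ne_zero
  have hy : fderiv ℂ f (t, y) (0, 1) = q.derivative.evalEval t y := by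
    have h1 : HasDerivAt (fun z : ℂ => f (t, z)) (fderiv ℂ f (t, y) (0, 1)) y :=
      hs.hasFDerivAt.comp_hasDerivAt y ((hasDerivAt_const y t).prodMk (hasDerivAt_id y))
    have h2 : HasDerivAt (fun z : ℂ => f (t, z)) (q.derivative.evalEval t y) y := by
      have := (q.map (evalRingHom t)).hasDerivAt y
      rw [derivative_map] at this
      simpa only [map_evalRingHom_eval] using this
    exact h1.unique h2
  set L : (ℂ × ℂ) →L[ℂ] (ℂ × ℂ) := (ContinuousLinearMap.fst ℂ ℂ ℂ).prod (fderiv ℂ f (t, y))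
  have hL : HasStrictFDerivAt (fun p : ℂ × ℂ => (p.1, f p)) L (t, y) :=
    hasStrictFDerivAt_fst.prodMk hs
  have hinj : Function.Injective L := by
    refine (injective_iff_map_eq_zero L).2 ?_
    rintro ⟨a, b⟩ hab
    have ha : a = 0 := congrArg Prod.fst hab
    have hb : fderiv ℂ f (t, y) (a, b) = 0 := congrArg Prod.snd hab
    subst ha
    have : ((0 : ℂ), b) = b • ((0 : ℂ), (1 : ℂ)) := by simp
    rw [this, map_smul, hy, smul_eq_mul, mul_eq_zero] at hb
    simpa [h] using hb
  let e : (ℂ × ℂ) ≃L[ℂ] (ℂ × ℂ) :=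
    (LinearEquiv.ofInjectiveEndo L.toLinearMap hinj).toContinuousLinearEquiv
  have he : (e : (ℂ × ℂ) →L[ℂ] (ℂ × ℂ)) = L := by ext <;> rfl
  rw [← he] at hL
  refine ⟨hL.toOpenPartialHomeomorph _, hL.mem_toOpenPartialHomeomorph_source, fun p => rfl, ?_⟩
  have := hL.to_localInverse
  exact this.hasFDerivAt.differentiableAt

theorem Polynomial.natDegree_map_evalRingHom {q : ℂ[X][X]} (hq : q.Monic) (t : ℂ) :
    (q.map (evalRingHom t)).natDegree = q.natDegree := hq.natDegree_map _

/-- The roots of a monic polynomial are bounded locally uniformly in the coefficients. -/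
theorem Polynomial.Monic.norm_le_of_evalEval_eq_zero {q : ℂ[X][X]} (hq : q.Monic) {t y : ℂ}
    (h : q.evalEval t y = 0) :
    ‖y‖ ≤ 1 + ∑ i ∈ Finset.range q.natDegree, ‖(q.coeff i).eval t‖ := by
  have hm : (q.map (evalRingHom t)).Monic := hq.map _
  have h1 : (q.map (evalRingHom t)).IsRoot y := by
    rwa [IsRoot.def, map_evalRingHom_eval]
  have h2 := IsRoot.norm_lt_cauchyBound hm.ne_zero h1
  refine (NNReal.coe_le_coe.2 h2.le).trans ?_
  rw [cauchyBound, hm.leadingCoeff, nnnorm_one, div_one, NNReal.coe_add, NNReal.coe_one, add_comm]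
  gcongr
  have h3 : (Finset.range (q.map (evalRingHom t)).natDegree).sup
      (fun i => ‖(q.map (evalRingHom t)).coeff i‖₊) ≤
      ∑ i ∈ Finset.range q.natDegree, ‖(q.coeff i).eval t‖₊ := by
    rw [natDegree_map_evalRingHom hq]
    refine Finset.sup_le fun i hi => ?_
    rw [coeff_map]
    exact Finset.single_le_sum (f := fun i => ‖(q.coeff i).eval t‖₊) (fun _ _ => zero_le) hi
  simpa using NNReal.coe_le_coe.2 h3

theorem Polynomial.Monic.exists_bound_of_isCompact {q : ℂ[X][X]} (hq : q.Monic) {K : Set ℂ}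
    (hK : IsCompact K) : ∃ B : ℝ, ∀ t ∈ K, ∀ y, q.evalEval t y = 0 → ‖y‖ ≤ B := by
  have hc : Continuous fun t : ℂ =>
      1 + ∑ i ∈ Finset.range q.natDegree, ‖(q.coeff i).eval t‖ := by fun_prop
  obtain ⟨B, hB⟩ := (hK.image hc).bddAbove
  exact ⟨B, fun t ht y hy => (hq.norm_le_of_evalEval_eq_zero hy).trans
    (hB (Set.mem_image_of_mem _ ht))⟩

/-- The affine plane curve `q = 0`. -/
abbrev Polynomial.PlaneCurve (q : ℂ[X][X]) : Type := {p : ℂ × ℂ // q.evalEval p.1 p.2 = 0}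

/-- The projection of the plane curve `q(t, y) = 0` to the `t`-line. -/
def Polynomial.PlaneCurve.proj (q : ℂ[X][X]) (p : q.PlaneCurve) : ℂ := p.1.1

theorem Polynomial.PlaneCurve.continuous_proj (q : ℂ[X][X]) : Continuous (proj q) :=
  continuous_fst.comp continuous_subtype_val

theorem Polynomial.Monic.isProperMap_proj {q : ℂ[X][X]} (hq : q.Monic) :
    IsProperMap (PlaneCurve.proj q) := by
  refine isProperMap_iff_isCompact_preimage.2 ⟨PlaneCurve.continuous_proj q, fun K hK => ?_⟩
  obtain ⟨B, hB⟩ := hq.exists_bound_of_isCompact hK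
  have hcl : IsClosed {p : ℂ × ℂ | q.evalEval p.1 p.2 = 0} :=
    isClosed_eq q.continuous_evalEval continuous_const
  rw [Subtype.isCompact_iff]
  refine (hK.prod (isCompact_closedBall (0 : ℂ) B)).of_isClosed_subset ?_ ?_
  · exact hcl.isClosedMap_subtype_val _ (hK.isClosed.preimage (PlaneCurve.continuous_proj q))
  · rintro _ ⟨p, hp, rfl⟩
    exact ⟨hp, by simpa using hB _ hp _ p.2⟩

theorem Polynomial.PlaneCurve.isLocalHomeomorphOn_proj (q : ℂ[X][X]) :
    IsLocalHomeomorphOn (proj q) {p | q.derivative.evalEval p.1.1 p.1.2 ≠ 0} := by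
  classical
  refine IsLocalHomeomorphOn.mk _ _ fun p hp => ?_
  obtain ⟨Φ, hmem, hΦ, -⟩ := q.exists_openPartialHomeomorph_evalEval _ _ hp
  have key : ∀ t : ℂ, (t, (0 : ℂ)) ∈ Φ.target →
      (Φ.symm (t, 0)).1 = t ∧ q.evalEval (Φ.symm (t, 0)).1 (Φ.symm (t, 0)).2 = 0 := by
    intro t ht
    have := Φ.right_inv ht
    rw [hΦ] at this
    exact ⟨congrArg Prod.fst this, congrArg Prod.snd this⟩
  have hΦ0 : ∀ x : q.PlaneCurve, Φ x.1 = (x.1.1, 0) := fun x => by rw [hΦ, x.2]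
  let g : ℂ → q.PlaneCurve := fun t =>
    if h : q.evalEval (Φ.symm (t, 0)).1 (Φ.symm (t, 0)).2 = 0 then ⟨Φ.symm (t, 0), h⟩ else p
  have hg : ∀ t : ℂ, (t, (0 : ℂ)) ∈ Φ.target → (g t).1 = Φ.symm (t, 0) := by
    intro t ht
    simp only [g, dif_pos (key t ht).2]
  refine ⟨{ toFun := proj q
            invFun := g
            source := Subtype.val ⁻¹' Φ.source
            target := (fun t : ℂ => (t, (0 : ℂ))) ⁻¹' Φ.target
            map_source' := fun x hx => ?_
            map_target' := fun t ht => ?_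
            left_inv' := fun x hx => ?_
            right_inv' := fun t ht => ?_
            open_source := Φ.open_source.preimage continuous_subtype_val
            open_target := Φ.open_target.preimage (by fun_prop)
            continuousOn_toFun := (continuous_proj q).continuousOn
            continuousOn_invFun := ?_ }, hmem, fun _ _ => rfl⟩
  · have := Φ.map_source hx
    rwa [hΦ0] at this
  · change (g t).1 ∈ Φ.source
    rw [hg t ht]
    exact Φ.map_target ht
  · have h1 := Φ.map_source hx
    rw [hΦ0] at h1
    apply Subtype.ext
    refine (hg _ h1).trans ?_
    rw [← hΦ0 x, Φ.left_inv hx]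
  · change (g t).1.1 = t
    rw [hg t ht, (key t ht).1]
  · refine Topology.IsInducing.subtypeVal.continuousOn_iff.2 ?_
    refine ContinuousOn.congr (f := fun t : ℂ => Φ.symm (t, 0)) ?_ fun t ht => hg t ht
    exact Φ.continuousOn_symm.comp (by fun_prop) fun t ht => ht

theorem Polynomial.Monic.isCoveringMapOn_proj {q : ℂ[X][X]} (hq : q.Monic) {s : Set ℂ}
    (hs : ∀ t ∈ s, ∀ y, q.evalEval t y = 0 → q.derivative.evalEval t y ≠ 0) :
    IsCoveringMapOn (PlaneCurve.proj q) s := by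
  refine hq.isProperMap_proj.isClosedMap.isCoveringMapOn_of_isLocalHomeomorphOn ?_ ?_
  · intro t _
    have hm : (q.map (evalRingHom t)).Monic := hq.map _
    refine Set.Finite.of_injOn (f := fun p : q.PlaneCurve => p.1.2)
      (t := {y | (q.map (evalRingHom t)).IsRoot y}) ?_ ?_ (finite_setOfPred_isRoot hm.ne_zero)
    · rintro ⟨⟨a, b⟩, h⟩ (rfl : a = t)
      simpa [IsRoot.def, map_evalRingHom_eval] using h
    · rintro ⟨⟨a, b⟩, h⟩ (rfl : a = t) ⟨⟨a', b'⟩, h'⟩ (rfl : a' = a) (hb : b = b')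
      subst hb; rfl
  · exact (PlaneCurve.isLocalHomeomorphOn_proj q).mono fun p hp => hs _ hp _ p.2

open Function.Periodic in
/-- `F` is a continuous choice of a root of `q(exp(2πiw), ·)` for `w` in the half-plane
`c < im w`. -/
structure IsRootFunction (q : ℂ[X][X]) (c : ℝ) (F : ℂ → ℂ) : Prop where
  continuousOn : ContinuousOn F {w | c < w.im}
  isRoot : ∀ w : ℂ, c < w.im → q.evalEval (qParam 1 w) (F w) = 0

section RootFunction

open Function.Periodic

theorem qParam_one_add_natCast (w : ℂ) (j : ℕ) : qParam 1 (w + j) = qParam 1 w := by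
  rw [qParam, qParam, Complex.exp_eq_exp_iff_exists_int]
  exact ⟨j, by push_cast; ring⟩

theorem qParam_natCast_pow {m : ℕ} (hm : 0 < m) (w : ℂ) : qParam m w ^ m = qParam 1 w := by
  have : (m : ℂ) ≠ 0 := by exact_mod_cast hm.ne'
  rw [qParam, qParam, ← Complex.exp_nat_mul]
  congr 1
  push_cast
  field_simp

instance simplyConnectedSpace_halfPlane (c : ℝ) :
    SimplyConnectedSpace ({w | c < w.im} : Set ℂ) := by
  have := (convex_halfSpace_im_gt c).contractibleSpace ⟨(c + 1) * Complex.I, by simp⟩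
  exact SimplyConnectedSpace.ofContractible _

theorem isOpen_halfPlane (c : ℝ) : IsOpen {w : ℂ | c < w.im} :=
  isOpen_lt continuous_const Complex.continuous_im

instance locallyPathConnectedSpace_halfPlane (c : ℝ) :
    LocallyPathConnectedSpace ({w | c < w.im} : Set ℂ) :=
  (isOpen_halfPlane c).locallyPathConnectedSpace

variable {q : ℂ[X][X]} {c : ℝ}

/-- The map `w ↦ exp(2πiw)` on a half-plane. -/
noncomputable def halfPlaneQParam (c : ℝ) : C(({w | c < w.im} : Set ℂ), ℂ) :=
  ⟨fun w => qParam 1 w, (continuous_qParam (h := 1)).comp continuous_subtype_val⟩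

theorem existsUnique_halfPlane_lift (hq : q.Monic)
    (hs : ∀ w : ℂ, c < w.im → ∀ y, q.evalEval (qParam 1 w) y = 0 →
      q.derivative.evalEval (qParam 1 w) y ≠ 0)
    (w₀ : ({w | c < w.im} : Set ℂ)) (e₀ : q.PlaneCurve) (h₀ : e₀.1.1 = qParam 1 w₀) :
    ∃! F : C(({w | c < w.im} : Set ℂ), q.PlaneCurve),
      F w₀ = e₀ ∧ PlaneCurve.proj q ∘ F = halfPlaneQParam c := by
  have hcov : IsCoveringMapOn (PlaneCurve.proj q) (Set.range (halfPlaneQParam c)) := by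
    refine hq.isCoveringMapOn_proj ?_
    rintro _ ⟨w, rfl⟩
    exact hs w.1 w.2
  exact hcov.existsUnique_continuousMap_lifts (halfPlaneQParam c) h₀ fun a => ⟨a, rfl⟩

theorem exists_isRootFunction (hq : q.Monic)
    (hs : ∀ w : ℂ, c < w.im → ∀ y, q.evalEval (qParam 1 w) y = 0 →
      q.derivative.evalEval (qParam 1 w) y ≠ 0)
    {w₀ y₀ : ℂ} (hw : c < w₀.im) (hy : q.evalEval (qParam 1 w₀) y₀ = 0) :
    ∃ F, IsRootFunction q c F ∧ F w₀ = y₀ := by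
  classical
  obtain ⟨G, ⟨hG0, hG⟩, -⟩ := existsUnique_halfPlane_lift hq hs ⟨w₀, hw⟩ ⟨(_, y₀), hy⟩ rfl
  refine ⟨fun w => if h : c < w.im then (G ⟨w, h⟩).1.2 else 0, ⟨?_, fun w h => ?_⟩, ?_⟩
  · rw [continuousOn_iff_continuous_domRestrict]
    refine (continuous_snd.comp (continuous_subtype_val.comp G.continuous)).congr fun w => ?_
    simp [show c < w.1.im from w.2]
  · simp only [dif_pos h]
    have h1 : (G ⟨w, h⟩).1.1 = qParam 1 w := congrFun hG ⟨w, h⟩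
    rw [← h1]
    exact (G ⟨w, h⟩).2
  · simp [hw, hG0]

theorem IsRootFunction.eq_of_eq_at {F G : ℂ → ℂ} (hF : IsRootFunction q c F)
    (hG : IsRootFunction q c G) (hq : q.Monic)
    (hs : ∀ w : ℂ, c < w.im → ∀ y, q.evalEval (qParam 1 w) y = 0 →
      q.derivative.evalEval (qParam 1 w) y ≠ 0)
    {w₀ : ℂ} (hw : c < w₀.im) (h : F w₀ = G w₀) {w : ℂ} (hw' : c < w.im) : F w = G w := by
  have lift : ∀ {F}, IsRootFunction q c F → ∃ L : C(({w | c < w.im} : Set ℂ), q.PlaneCurve),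
      ∀ w, (L w).1 = (qParam 1 w, F w) := fun {F} hF =>
    ⟨⟨fun w => ⟨(qParam 1 w, F w), hF.isRoot w w.2⟩, by
      refine Continuous.subtype_mk (Continuous.prodMk (halfPlaneQParam c).continuous ?_) _
      exact continuousOn_iff_continuous_domRestrict.1 hF.continuousOn⟩, fun _ => rfl⟩
  obtain ⟨L, hL⟩ := lift hF
  obtain ⟨M, hM⟩ := lift hG
  have := (existsUnique_halfPlane_lift hq hs ⟨w₀, hw⟩ ⟨(_, F w₀), hF.isRoot _ hw⟩ rfl).unique
    (y₁ := L) (y₂ := M) ⟨Subtype.ext (hL _), funext fun w => congrArg Prod.fst (hL w)⟩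
    ⟨Subtype.ext ((hM _).trans (Prod.ext rfl h.symm)), funext fun w => congrArg Prod.fst (hM w)⟩
  have h2 := hL ⟨w, hw'⟩
  rw [this, hM] at h2
  exact (congrArg Prod.snd h2).symm

theorem IsRootFunction.comp_add_natCast {F : ℂ → ℂ} (hF : IsRootFunction q c F) (j : ℕ) :
    IsRootFunction q c fun w => F (w + j) where
  continuousOn := hF.continuousOn.comp (by fun_prop) fun w hw => by simpa using hw
  isRoot w hw := by
    rw [← qParam_one_add_natCast w j]
    exact hF.isRoot _ (by simpa using hw)

theorem IsRootFunction.exists_period {F : ℂ → ℂ} (hF : IsRootFunction q c F) (hq : q.Monic)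
    (hs : ∀ w : ℂ, c < w.im → ∀ y, q.evalEval (qParam 1 w) y = 0 →
      q.derivative.evalEval (qParam 1 w) y ≠ 0) :
    ∃ m : ℕ, 0 < m ∧ ∀ w : ℂ, c < w.im → F (w + m) = F w := by
  set w₀ : ℂ := (c + 1) * Complex.I
  have hw : c < w₀.im := by simp [w₀]
  have hfin : {y | (q.map (evalRingHom (qParam 1 w₀))).IsRoot y}.Finite :=
    finite_setOfPred_isRoot (hq.map _).ne_zero
  obtain ⟨i, -, j, -, hij, h⟩ := Set.infinite_univ.exists_lt_map_eq_of_mapsTo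
    (f := fun j : ℕ => F (w₀ + j)) (t := {y | (q.map (evalRingHom (qParam 1 w₀))).IsRoot y})
    (fun j _ => by
      have := (hF.comp_add_natCast j).isRoot w₀ hw
      simpa [IsRoot.def, map_evalRingHom_eval] using this) hfin
  refine ⟨j - i, by omega, fun w hw' => ?_⟩
  refine (hF.comp_add_natCast (j - i)).eq_of_eq_at hF hq hs (w₀ := w₀ + i) (by simpa using hw) ?_
    hw'
  rw [show w₀ + i + ((j - i : ℕ) : ℂ) = w₀ + j by push_cast [Nat.cast_sub hij.le]; ring]
  exact h.symm

theorem IsRootFunction.differentiableAt {F : ℂ → ℂ} (hF : IsRootFunction q c F)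
    (hs : ∀ w : ℂ, c < w.im → ∀ y, q.evalEval (qParam 1 w) y = 0 →
      q.derivative.evalEval (qParam 1 w) y ≠ 0)
    {w : ℂ} (hw : c < w.im) : DifferentiableAt ℂ F w := by
  obtain ⟨Φ, hmem, hΦ, hd⟩ := q.exists_openPartialHomeomorph_evalEval _ _
    (hs w hw _ (hF.isRoot w hw))
  rw [hF.isRoot w hw] at hd
  have hnhds := (isOpen_halfPlane c).mem_nhds hw
  have hc : ContinuousAt (fun v => (qParam 1 v, F v)) w :=
    (continuous_qParam (h := 1)).continuousAt.prodMk (hF.continuousOn.continuousAt hnhds)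
  have hev : F =ᶠ[𝓝 w] fun v => (Φ.symm (qParam 1 v, 0)).2 := by
    filter_upwards [hc.preimage_mem_nhds (Φ.open_source.mem_nhds hmem), hnhds] with v hv hv'
    have h1 := Φ.left_inv hv
    rw [hΦ, hF.isRoot v hv'] at h1
    rw [h1]
  refine DifferentiableAt.congr_of_eventuallyEq ?_ hev
  have h2 : DifferentiableAt ℂ (fun v : ℂ => (qParam 1 v, (0 : ℂ))) w :=
    (differentiable_qParam (h := 1) w).prodMk (differentiableAt_const 0)
  exact (DifferentiableAt.comp w (g := Φ.symm) (f := fun v : ℂ => (qParam 1 v, (0 : ℂ))) hd h2).snd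

/-- A root function becomes holomorphic at the puncture after passing to a root of the
parameter. -/
theorem IsRootFunction.exists_analyticAt {F : ℂ → ℂ} (hF : IsRootFunction q c F) (hq : q.Monic)
    (hs : ∀ w : ℂ, c < w.im → ∀ y, q.evalEval (qParam 1 w) y = 0 →
      q.derivative.evalEval (qParam 1 w) y ≠ 0)
    {m : ℕ} (hm : 0 < m) (hper : ∀ w : ℂ, c < w.im → F (w + m) = F w) :
    ∃ g : ℂ → ℂ, AnalyticAt ℂ g 0 ∧ ∀ w : ℂ, c < w.im → g (qParam m w) = F w := by
  classical
  have hm' : (0 : ℝ) < m := by exact_mod_cast hm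
  set f : ℂ → ℂ := fun w => if c < w.im then F w else 0 with hf
  have hfF : ∀ w : ℂ, c < w.im → f w = F w := fun w hw => if_pos hw
  have hfp : Function.Periodic f (m : ℝ) := by
    intro w
    by_cases hw : c < w.im
    · simp [hf, hw, hper w hw]
    · simp [hf, hw]
  have hev : ∀ᶠ w : ℂ in comap Complex.im atTop, c < w.im :=
    (eventually_gt_atTop c).comap _
  have hhol : ∀ᶠ w : ℂ in comap Complex.im atTop, DifferentiableAt ℂ f w := by
    filter_upwards [hev] with w hw
    refine (hF.differentiableAt hs hw).congr_of_eventuallyEq ?_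
    filter_upwards [(isOpen_halfPlane c).mem_nhds hw] with v hv using hfF v hv
  have hbd : BoundedAtFilter (comap Complex.im atTop) f := by
    obtain ⟨B, hB⟩ := hq.exists_bound_of_isCompact
      (isCompact_closedBall (0 : ℂ) (Real.exp (-2 * Real.pi * c / 1)))
    refine Asymptotics.IsBigO.of_bound B ?_
    filter_upwards [hev] with w hw
    rw [hfF w hw]
    simpa using hB (qParam 1 w)
      (by simpa using ((norm_qParam_lt_iff one_pos c w).2 hw).le) _ (hF.isRoot w hw)
  refine ⟨cuspFunction m f, ?_, fun w hw => ?_⟩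
  · rw [Complex.analyticAt_iff_eventually_differentiableAt, ← nhdsNE_sup_pure, eventually_sup]
    exact ⟨eventually_differentiableAt_cuspFunction_nhds_ne_zero hm' hfp hhol,
      by simpa using differentiableAt_cuspFunction_zero hm' hfp hhol hbd⟩
  · rw [eq_cuspFunction hm'.ne' hfp, hfF w hw]

end RootFunction

open Function.Periodic in
/-- After adjoining a root of the parameter, a monic polynomial over `ℂ[t]` which is separable over
`ℂ(t)` splits into linear factors with holomorphic roots near `t = 0`. -/
theorem Polynomial.Monic.exists_analyticAt_splitting {q : ℂ[X][X]} (hq : q.Monic)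
    {a b : ℂ[X][X]} {r : ℂ[X]} (hr : r ≠ 0) (hab : a * q + b * q.derivative = C r) :
    ∃ m : ℕ, 0 < m ∧ ∀ M : ℕ, 0 < M → m ∣ M → ∃ (ι : Type) (_ : Fintype ι) (g : ι → ℂ → ℂ),
      (∀ k, AnalyticAt ℂ (g k) 0) ∧
      ∀ᶠ s in 𝓝 (0 : ℂ), ∀ y, q.evalEval (s ^ M) y = ∏ k, (y - g k s) := by
  classical
  have hev : ∀ᶠ t : ℂ in 𝓝[≠] 0, r.eval t ≠ 0 := by
    have hfin : {t | r.IsRoot t}.Finite := finite_setOfPred_isRoot hr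
    have hcl := (hfin.subset (Set.sdiff_subset (t := {0}))).isClosed
    filter_upwards [nhdsWithin_le_nhds (hcl.compl_mem_nhds (x := 0) (by simp)),
      self_mem_nhdsWithin] with t ht ht0 h
    exact ht ⟨h, ht0⟩
  obtain ⟨δ, hδ, hδr⟩ := Metric.mem_nhdsWithin_iff.1 hev
  set c : ℝ := -Real.log δ / (2 * Real.pi) with hc
  have hexp : Real.exp (-2 * Real.pi * c / 1) = δ := by
    rw [hc]
    field_simp
    rw [Real.exp_log hδ]
  have hs : ∀ w : ℂ, c < w.im → ∀ y, q.evalEval (qParam 1 w) y = 0 →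
      q.derivative.evalEval (qParam 1 w) y ≠ 0 := by
    intro w hw y hy hy'
    have h1 := congrArg (evalEval (qParam 1 w) y) hab
    rw [evalEval_add, evalEval_mul, evalEval_mul, hy, hy', evalEval_C] at h1
    have h2 := (norm_qParam_lt_iff one_pos c w).2 hw
    rw [hexp] at h2
    exact hδr ⟨by simpa using h2, qParam_ne_zero w⟩ (by simpa using h1.symm)
  set w₀ : ℂ := (c + 1) * Complex.I
  have hw₀ : c < w₀.im := by simp [w₀]
  set p₀ := q.map (evalRingHom (qParam 1 w₀))
  have hroot : ∀ y : {y // y ∈ p₀.roots.toFinset}, q.evalEval (qParam 1 w₀) y = 0 := by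
    rintro ⟨y, hy⟩
    have := (mem_roots'.1 (Multiset.mem_toFinset.1 hy)).2
    rwa [IsRoot.def, map_evalRingHom_eval] at this
  have hcard : Fintype.card {y // y ∈ p₀.roots.toFinset} = q.natDegree := by
    have hnd : p₀.roots.Nodup := by
      rw [Multiset.nodup_iff_count_le_one]
      intro y
      rw [count_roots]
      by_contra! h
      have h1 := (one_lt_rootMultiplicity_iff_isRoot (hq.map _).ne_zero).1 h
      have h2 := h1.2
      rw [derivative_map, IsRoot.def, map_evalRingHom_eval] at h2
      have h3 := h1.1
      rw [IsRoot.def, map_evalRingHom_eval] at h3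
      exact hs w₀ hw₀ y h3 h2
    rw [Fintype.card_coe, Multiset.toFinset_card_of_nodup hnd,
      splits_iff_card_roots.1 (IsAlgClosed.splits p₀), natDegree_map_evalRingHom hq]
  choose F hF hF0 using fun y => exists_isRootFunction hq hs hw₀ (hroot y)
  have hprod : ∀ w : ℂ, c < w.im → ∀ y, q.evalEval (qParam 1 w) y = ∏ k, (y - F k w) := by
    intro w hw y
    have hinj : Function.Injective fun k => F k w := by
      intro k l hkl
      have := (hF k).eq_of_eq_at (hF l) hq hs hw hkl hw₀
      rw [hF0, hF0] at this
      exact Subtype.ext this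
    have hdvd : ∏ k, (X - C (F k w)) ∣ q.map (evalRingHom (qParam 1 w)) := by
      refine Finset.prod_dvd_of_coprime
        ((pairwise_coprime_X_sub_C hinj).set_pairwise _) fun k _ => ?_
      rw [dvd_iff_isRoot, IsRoot.def, map_evalRingHom_eval]
      exact (hF k).isRoot w hw
    have heq := eq_of_monic_of_dvd_of_natDegree_le (monic_prod_of_monic _ _ fun k _ =>
      monic_X_sub_C (F k w)) (hq.map (evalRingHom (qParam 1 w))) hdvd (by
        rw [natDegree_map_evalRingHom hq, natDegree_prod_of_monic _ _ fun k _ =>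
          monic_X_sub_C (F k w)]
        simp [← hcard])
    rw [← map_evalRingHom_eval, heq, eval_prod]
    simp
  choose m hm hper using fun k => (hF k).exists_period hq hs
  refine ⟨∏ k, m k, Finset.prod_pos fun k _ => hm k, fun M hM hdvd => ?_⟩
  have hperM : ∀ k, ∀ w : ℂ, c < w.im → F k (w + M) = F k w := by
    intro k
    obtain ⟨l, rfl⟩ := (Finset.dvd_prod_of_mem m (Finset.mem_univ k)).trans hdvd
    clear hM hdvd
    induction l with
    | zero => simp
    | succ l ih =>
      intro w hw
      have := hper k (w + (m k * l : ℕ)) (by simpa using hw)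
      rw [← ih w hw, ← this]
      congr 1
      push_cast
      ring
  choose g hg hgF using fun k => (hF k).exists_analyticAt hq hs hM (hperM k)
  refine ⟨_, inferInstance, g, hg, ?_⟩
  have hne : ∀ᶠ s : ℂ in 𝓝[≠] 0, ∀ y, q.evalEval (s ^ M) y = ∏ k, (y - g k s) := by
    have hM' : (0 : ℝ) < M := by exact_mod_cast hM
    have h1 := (invQParam_tendsto hM').eventually
      (show ∀ᶠ w : ℂ in comap Complex.im atTop, c < w.im from (eventually_gt_atTop c).comap _)
    filter_upwards [h1, self_mem_nhdsWithin] with s hsc hs0 y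
    have h2 := hprod _ hsc y
    rw [← qParam_natCast_pow hM, qParam_right_inv hM'.ne' hs0] at h2
    rw [h2]
    refine Finset.prod_congr rfl fun k _ => ?_
    rw [← hgF k _ hsc, qParam_right_inv hM'.ne' hs0]
  rw [← nhdsNE_sup_pure, eventually_sup]
  refine ⟨hne, fun y => ?_⟩
  have hl : Tendsto (fun s : ℂ => q.evalEval (s ^ M) y) (𝓝[≠] 0) (𝓝 (q.evalEval (0 ^ M) y)) :=
    ((q.continuous_evalEval.comp (by fun_prop :
      Continuous fun s : ℂ => (s ^ M, y))).tendsto 0).mono_left nhdsWithin_le_nhds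
  have hr' : Tendsto (fun s : ℂ => ∏ k, (y - g k s)) (𝓝[≠] 0) (𝓝 (∏ k, (y - g k 0))) :=
    (tendsto_finsetProd _ fun k _ =>
      tendsto_const_nhds.sub (hg k).continuousAt.tendsto).mono_left nhdsWithin_le_nhds
  exact tendsto_nhds_unique (hl.congr' (hne.mono fun s h => h y)) hr'

/-- In characteristic zero, an irreducible monic polynomial over an integrally closed domain is
separable over the fraction field, in the form of a Bézout identity without denominators. -/
theorem Polynomial.Monic.exists_mul_add_mul_derivative_eq_C {R : Type*} [CommRing R] [IsDomain R]
    [IsIntegrallyClosed R] [CharZero R] {q : R[X]} (hq : q.Monic) (hirr : Irreducible q) :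
    ∃ (a b : R[X]) (r : R), r ≠ 0 ∧ a * q + b * q.derivative = C r := by
  have h0 : q.natDegree ≠ 0 := fun h =>
    hirr.not_isUnit (by rw [eq_one_of_monic_natDegree_zero hq h]; exact isUnit_one)
  obtain ⟨a, b, -, -, hab⟩ := exists_mul_add_mul_eq_C_resultant q q.derivative le_rfl le_rfl
    (.inl h0)
  refine ⟨a, b, resultant q q.derivative, fun h => ?_, by rw [← hab]; ring⟩
  let K := FractionRing R
  have hinj := IsFractionRing.injective R K
  have : CharZero K := charZero_of_injective_algebraMap hinj
  have hsep : (q.map (algebraMap R K)).Separable :=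
    ((hq.irreducible_iff_irreducible_map_fraction_map).1 hirr).separable
  have h1 := resultant_map_map q q.derivative q.natDegree q.derivative.natDegree (algebraMap R K)
  rw [h, map_zero, ← natDegree_map_eq_of_injective hinj q,
    ← natDegree_map_eq_of_injective hinj q.derivative, ← derivative_map, resultant_eq_zero_iff] at h1
  exact h1.2 hsep

open MvPolynomial in
/-- A closed point of affine `n`-space over an algebraically closed field has codimension `n`. -/
theorem MvPolynomial.height_vanishingIdeal_singleton {σ K : Type*} [Finite σ] [Field K]
    [IsAlgClosed K] (p : σ → K) : (vanishingIdeal K {p}).height = Nat.card σ := by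
  have hdim : ringKrullDim (MvPolynomial σ K) = Nat.card σ := by simp
  have : FiniteRingKrullDim (MvPolynomial σ K) :=
    finiteRingKrullDim_iff_ne_bot_and_top.2 ⟨by rw [hdim]; exact WithBot.natCast_ne_bot _, by
      rw [hdim]; exact fun h => ENat.natCast_ne_top _ (WithBot.coe_injective h)⟩
  obtain ⟨M, hM, hht⟩ := Ideal.exists_isMaximal_height (R := MvPolynomial σ K)
  obtain ⟨x, rfl⟩ := isMaximal_iff_eq_vanishingIdeal_singleton.1 hM
  let e : MvPolynomial σ K ≃ₐ[K] MvPolynomial σ K :=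
    AlgEquiv.ofAlgHom (aeval fun i => X i + C (p i - x i)) (aeval fun i => X i - C (p i - x i))
      (by ext i; simp) (by ext i; simp)
  have he : (vanishingIdeal K {x}).comap e.toRingEquiv = vanishingIdeal K {p} := by
    ext f
    have : aeval x (e f) = aeval p f := by
      have h : (aeval x).comp e.toAlgHom = aeval (R := K) p := by ext i; simp [e]
      exact congr($h f)
    simpa [mem_vanishingIdeal_singleton_iff] using by rw [show eval x (e f) = eval p f from this]
  rw [← he, RingEquiv.height_comap]
  rw [hdim] at hht
  exact_mod_cast hht

open MvPolynomial in
/-- A prime ideal whose zero locus meets `h ≠ 0` at most in the point `p` is the ideal of `p`,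
unless it contains `h`. -/
theorem MvPolynomial.eq_vanishingIdeal_singleton_of_isPrime {σ K : Type*} [Finite σ] [Field K]
    [IsAlgClosed K] {p : σ → K} {h : MvPolynomial σ K} {Q : Ideal (MvPolynomial σ K)} [Q.IsPrime]
    (hh : h ∉ Q) (hQ : ∀ x, (∀ f ∈ Q, eval x f = 0) → eval x h ≠ 0 → x = p) :
    Q = vanishingIdeal K {p} := by
  have hmax : (vanishingIdeal K {p}).IsMaximal :=
    isMaximal_iff_eq_vanishingIdeal_singleton.2 ⟨p, rfl⟩
  refine (hmax.eq_of_le (Ideal.IsPrime.ne_top ‹_›) fun g hg => ?_).symm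
  rw [mem_vanishingIdeal_singleton_iff] at hg
  have : h * g ∈ vanishingIdeal K (zeroLocus K Q) := by
    rw [mem_vanishingIdeal_iff]
    intro x hx
    rw [mem_zeroLocus_iff] at hx
    rw [map_mul, mul_eq_zero]
    by_cases hxh : eval x h = 0
    · exact .inl hxh
    · rw [hQ x hx hxh]; exact .inr hg
  rw [IsPrime.vanishingIdeal_zeroLocus] at this
  exact (Ideal.IsPrime.mem_or_mem ‹_› this).resolve_left hh

open MvPolynomial in
/-- If fewer than `n` polynomials in `n` variables vanish at `p`, they all lie in a prime ideal
which is strictly contained in the ideal of `p`. -/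
theorem MvPolynomial.exists_isPrime_lt_vanishingIdeal_singleton {σ K : Type*} [Finite σ] [Field K]
    [IsAlgClosed K] (p : σ → K) (s : Finset (MvPolynomial σ K)) (hs : s.card < Nat.card σ)
    (hp : ∀ f ∈ s, eval p f = 0) :
    ∃ P : Ideal (MvPolynomial σ K), P.IsPrime ∧ (∀ f ∈ s, f ∈ P) ∧ P < vanishingIdeal K {p} := by
  have hmax : (vanishingIdeal K {p}).IsMaximal :=
    isMaximal_iff_eq_vanishingIdeal_singleton.2 ⟨p, rfl⟩
  have hle : Ideal.span (s : Set (MvPolynomial σ K)) ≤ vanishingIdeal K {p} := by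
    rw [Ideal.span_le]
    exact fun f hf => (mem_vanishingIdeal_singleton_iff _ _).2 (hp f hf)
  obtain ⟨P, hP, hPle⟩ := Ideal.exists_minimalPrimes_le hle
  refine ⟨P, hP.1.1, fun f hf => hP.1.2 (Ideal.subset_span hf), lt_of_le_of_ne hPle ?_⟩
  rintro rfl
  have := Ideal.height_le_card_of_mem_minimalPrimes_span_finset hP
  rw [height_vanishingIdeal_singleton] at this
  exact absurd hs (not_lt.2 (by exact_mod_cast this))

/-- A finite type algebra satisfies the conclusion of Zariski's main theorem at a prime which is
isolated in its fibre. -/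
theorem Algebra.ZariskisMainProperty.of_isolated {R S : Type*} [CommRing R] [CommRing S]
    [Algebra R S] [Algebra.FiniteType R S] {q : Ideal S} [hq : q.IsPrime] {h : S} (hh : h ∉ q)
    (H : ∀ Q : Ideal S, Q.IsPrime → Q.comap (algebraMap R S) = q.comap (algebraMap R S) →
      h ∉ Q → Q = q) :
    Algebra.ZariskisMainProperty R q := by
  have : Algebra.QuasiFiniteAt R (PrimeSpectrum.mk q hq).asIdeal := by
    refine Algebra.QuasiFiniteAt.of_isOpen_singleton_fiber (R := R) ⟨q, hq⟩ ?_
    convert (PrimeSpectrum.basicOpen h).isOpen.preimage continuous_subtype_val using 1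
    ext ⟨Q, hQ⟩
    constructor
    · rintro ⟨⟩
      exact hh
    · intro hQh
      exact Subtype.ext (PrimeSpectrum.ext
        (H Q.asIdeal Q.isPrime congr(PrimeSpectrum.asIdeal $hQ) hQh))
  exact Algebra.ZariskisMainProperty.of_finiteType (R := R) (PrimeSpectrum.mk q hq).asIdeal

/-- A homomorphism to a field which does not kill `r` extends along a map which becomes bijective
after inverting `r`. -/
theorem RingHom.exists_extend_of_bijective_awayMap {B S K : Type*} [CommRing B] [CommRing S]
    [Field K] (i : B →+* S) {r : B} (hbij : Function.Bijective (Localization.awayMap i r))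
    (φ : B →+* K) (hr : φ r ≠ 0) : ∃ ψ : S →+* K, ψ.comp i = φ := by
  let e := RingEquiv.ofBijective _ hbij
  let l : Localization.Away r →+* K := IsLocalization.Away.lift r hr.isUnit
  refine ⟨(l.comp e.symm.toRingHom).comp (algebraMap S (Localization.Away (i r))), ?_⟩
  ext b
  have h : e (algebraMap B _ b) = algebraMap S (Localization.Away (i r)) (i b) := by
    simp [e, Localization.awayMap, IsLocalization.Away.map, IsLocalization.map_eq]
  have h2 : e.symm (algebraMap S (Localization.Away (i r)) (i b)) = algebraMap B _ b := by
    rw [← h, e.symm_apply_apply]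
  simp [h2, l]

section Integral

variable {B : Type*} [CommRing B] [Algebra ℂ[X] B]

theorem evalEval_eq_of_aeval_eq {φ : B →+* ℂ} {t : ℂ}
    (hφ : ∀ p : ℂ[X], φ (algebraMap ℂ[X] B p) = p.eval t) (e : B) (q : ℂ[X][X]) :
    φ (aeval e q) = q.evalEval t (φ e) := by
  rw [aeval_def, hom_eval₂, ← map_evalRingHom_eval, eval_map]
  congr 1
  ext p <;> simp [hφ]

/-- Every root of a specialization of the minimal polynomial of `e` is the value of `e` at a
point of the corresponding fibre. -/
theorem exists_ringHom_of_evalEval_minpoly [IsDomain B] [FaithfulSMul ℂ[X] B]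
    [Algebra.IsIntegral ℂ[X] B] (e : B) {t y : ℂ} (h : (minpoly ℂ[X] e).evalEval t y = 0) :
    ∃ φ : B →+* ℂ, (∀ p : ℂ[X], φ (algebraMap ℂ[X] B p) = p.eval t) ∧ φ e = y := by
  let ev : ℂ[X][X] →+* ℂ := evalEvalRingHom t y
  have hev : Function.Surjective ev := fun z => ⟨C (C z), by simp [ev]⟩
  have hmax : (RingHom.ker ev).IsMaximal := RingHom.ker_isMaximal_of_surjective ev hev
  let alg : Algebra ℂ[X][X] B := (aeval e : ℂ[X][X] →ₐ[ℂ[X]] B).toRingHom.toAlgebra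
  have hal : ∀ q : ℂ[X][X], algebraMap ℂ[X][X] B q = aeval e q := fun _ => rfl
  have : IsScalarTower ℂ[X] ℂ[X][X] B := IsScalarTower.of_algebraMap_eq fun p => by
    rw [hal, algebraMap_eq, aeval_C]
  have : Algebra.IsIntegral ℂ[X][X] B := Algebra.IsIntegral.tower_top ℂ[X]
  have hker : RingHom.ker (algebraMap ℂ[X][X] B) ≤ RingHom.ker ev := by
    intro q hq
    rw [RingHom.mem_ker, hal, minpoly.isIntegrallyClosed_dvd_iff
      (Algebra.IsIntegral.isIntegral e)] at hq
    obtain ⟨r, rfl⟩ := hq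
    rw [RingHom.mem_ker, map_mul]
    exact mul_eq_zero_of_left h _
  obtain ⟨Q, hQ, hQc⟩ := Ideal.exists_ideal_over_maximal_of_isIntegral (RingHom.ker ev) hker
  let := Ideal.Quotient.field Q
  have hmod : ∀ q : ℂ[X][X], Ideal.Quotient.mk Q (aeval e q) =
      Ideal.Quotient.mk Q (algebraMap ℂ[X] B (C (q.evalEval t y))) := by
    intro q
    rw [Ideal.Quotient.eq]
    have : q - C (C (q.evalEval t y)) ∈ Q.comap (algebraMap ℂ[X][X] B) := by
      rw [hQc, RingHom.mem_ker]
      simp [ev]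
    simpa [hal] using this
  let ι : ℂ →+* B ⧸ Q := (Ideal.Quotient.mk Q).comp ((algebraMap ℂ[X] B).comp C)
  let : Algebra ℂ (B ⧸ Q) := ι.toAlgebra
  have hcoef : ∀ p : ℂ[X], Ideal.Quotient.mk Q (algebraMap ℂ[X] B p) = ι (p.eval t) := by
    intro p
    have := hmod (C p)
    rwa [aeval_C, evalEval_C] at this
  have : Algebra.IsIntegral ℂ (B ⧸ Q) := by
    refine ⟨fun b => ?_⟩
    obtain ⟨b, rfl⟩ := Ideal.Quotient.mk_surjective b
    obtain ⟨q, hq, hq0⟩ := Algebra.IsIntegral.isIntegral (R := ℂ[X]) b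
    refine ⟨q.map (evalRingHom t), hq.map _, ?_⟩
    rw [eval₂_map]
    have := congrArg (Ideal.Quotient.mk Q) hq0
    rw [hom_eval₂, map_zero] at this
    rw [← this]
    congr 1
    exact RingHom.ext fun p => (hcoef p).symm
  let E := RingEquiv.ofBijective _ (IsAlgClosed.algebraMap_bijective_of_isIntegral
    (k := ℂ) (K := B ⧸ Q))
  have hE : ∀ z, E.symm (ι z) = z := E.symm_apply_apply
  refine ⟨E.symm.toRingHom.comp (Ideal.Quotient.mk Q), fun p => ?_, ?_⟩
  · change E.symm (Ideal.Quotient.mk Q (algebraMap ℂ[X] B p)) = _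
    rw [hcoef, hE]
  · have := hmod X
    simp only [aeval_X, evalEval_X] at this
    have h2 : Ideal.Quotient.mk Q e = ι y := this
    simp [h2, hE]

end Integral

/-- Through a point of an integral extension of `ℂ[t]` over `t = 0`, finitely many functions can
be followed along a holomorphic branch, after adjoining a root of `t`. -/
theorem exists_analyticAt_branch {B : Type*} [CommRing B] [Algebra ℂ[X] B] [IsDomain B]
    [FaithfulSMul ℂ[X] B] [Algebra.IsIntegral ℂ[X] B] (π : B →+* ℂ)
    (hπ : ∀ p : ℂ[X], π (algebraMap ℂ[X] B p) = p.eval 0) {J : Type*} [Finite J] (y : J → B) :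
    ∃ m : ℕ, 0 < m ∧ ∃ g : J → ℂ → ℂ, (∀ j, AnalyticAt ℂ (g j) 0) ∧ (∀ j, g j 0 = π (y j)) ∧
      ∃ᶠ s in 𝓝[≠] (0 : ℂ), ∃ φ : B →+* ℂ,
        (∀ p : ℂ[X], φ (algebraMap ℂ[X] B p) = p.eval (s ^ m)) ∧ ∀ j, φ (y j) = g j s := by
  classical
  have := Fintype.ofFinite J
  have split : ∀ b : B, ∃ m : ℕ, 0 < m ∧ ∀ M : ℕ, 0 < M → m ∣ M →
      ∃ (ι : Type) (_ : Fintype ι) (g : ι → ℂ → ℂ), (∀ k, AnalyticAt ℂ (g k) 0) ∧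
        ∀ᶠ s in 𝓝 (0 : ℂ), ∀ z, (minpoly ℂ[X] b).evalEval (s ^ M) z = ∏ k, (z - g k s) := by
    intro b
    have hb : IsIntegral ℂ[X] b := Algebra.IsIntegral.isIntegral b
    obtain ⟨a, a', r, hr, hab⟩ :=
      (minpoly.monic hb).exists_mul_add_mul_derivative_eq_C (minpoly.irreducible hb)
    exact (minpoly.monic hb).exists_analyticAt_splitting hr hab
  have root : ∀ (φ : B →+* ℂ) (t : ℂ), (∀ p : ℂ[X], φ (algebraMap ℂ[X] B p) = p.eval t) →
      ∀ b, (minpoly ℂ[X] b).evalEval t (φ b) = 0 := by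
    intro φ t hφ b
    rw [← evalEval_eq_of_aeval_eq hφ, minpoly.aeval, map_zero]
  let S : J → Finset ℂ := fun j =>
    ((minpoly ℂ[X] (y j)).map (evalRingHom 0)).roots.toFinset.erase (π (y j))
  let e : B := ∏ j, ∏ γ ∈ S j, (y j - algebraMap ℂ[X] B (C γ))
  have hπe : π e ≠ 0 := by
    simp only [e, map_prod, map_sub, hπ, eval_C]
    refine Finset.prod_ne_zero_iff.2 fun j _ => Finset.prod_ne_zero_iff.2 fun γ hγ => ?_
    exact sub_ne_zero.2 (Finset.ne_of_mem_erase hγ).symm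
  choose m hm hsplit using fun j => split (y j)
  obtain ⟨m', hm', hsplit'⟩ := split e
  set M := (∏ j, m j) * m'
  have hM : 0 < M := Nat.mul_pos (Finset.prod_pos fun j _ => hm j) hm'
  choose ι hι g hg hgs using fun j =>
    hsplit j M hM ((Finset.dvd_prod_of_mem m (Finset.mem_univ j)).mul_right _)
  obtain ⟨ι', hι', g', hg', hgs'⟩ := hsplit' M hM (dvd_mul_left _ _)
  have h0M : (0 : ℂ) ^ M = 0 := zero_pow hM.ne'
  obtain ⟨k', hk'⟩ : ∃ k', g' k' 0 = π e := by
    have h1 := hgs'.self_of_nhds (π e)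
    rw [h0M, root π 0 hπ, eq_comm, Finset.prod_eq_zero_iff] at h1
    obtain ⟨k', -, h⟩ := h1
    exact ⟨k', (sub_eq_zero.1 h).symm⟩
  have key : ∀ᶠ s in 𝓝[≠] (0 : ℂ), ∃ κ : ∀ j, ι j, ∃ φ : B →+* ℂ,
      (∀ p : ℂ[X], φ (algebraMap ℂ[X] B p) = p.eval (s ^ M)) ∧ φ e = g' k' s ∧
        ∀ j, φ (y j) = g j (κ j) s := by
    refine nhdsWithin_le_nhds ?_
    filter_upwards [hgs', eventually_all.2 hgs] with s hs' hs
    obtain ⟨φ, hφ, hφe⟩ := exists_ringHom_of_evalEval_minpoly e (t := s ^ M) (y := g' k' s) (by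
      rw [hs', Finset.prod_eq_zero (Finset.mem_univ k') (sub_self _)])
    have : ∀ j, ∃ k, φ (y j) = g j k s := by
      intro j
      have h1 := hs j (φ (y j))
      rw [root φ _ hφ, eq_comm, Finset.prod_eq_zero_iff] at h1
      obtain ⟨k, -, h⟩ := h1
      exact ⟨k, sub_eq_zero.1 h⟩
    choose κ hκ using this
    exact ⟨κ, φ, hφ, hφe, hκ⟩
  obtain ⟨κ, hκ⟩ : ∃ κ : ∀ j, ι j, ∃ᶠ s in 𝓝[≠] (0 : ℂ), ∃ φ : B →+* ℂ,
      (∀ p : ℂ[X], φ (algebraMap ℂ[X] B p) = p.eval (s ^ M)) ∧ φ e = g' k' s ∧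
        ∀ j, φ (y j) = g j (κ j) s := by
    by_contra hcon
    obtain ⟨s, ⟨κ, hs⟩, hs'⟩ := (key.and (eventually_all.2 fun κ =>
      not_frequently.1 (not_exists.1 hcon κ))).exists
    exact hs' κ hs
  refine ⟨M, hM, fun j => g j (κ j), fun j => hg j _, fun j => ?_,
    hκ.mono fun s ⟨φ, hφ, _, hφy⟩ => ⟨φ, hφ, hφy⟩⟩
  have hlim : ∏ j, ∏ γ ∈ S j, (g j (κ j) 0 - γ) = g' k' 0 := by
    have h1 : Tendsto (fun s => ∏ j, ∏ γ ∈ S j, (g j (κ j) s - γ)) (𝓝[≠] 0)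
        (𝓝 (∏ j, ∏ γ ∈ S j, (g j (κ j) 0 - γ))) :=
      (tendsto_finsetProd _ fun j _ => tendsto_finsetProd _ fun γ _ =>
        (hg j (κ j)).continuousAt.tendsto.sub tendsto_const_nhds).mono_left nhdsWithin_le_nhds
    have h2 : Tendsto (g' k') (𝓝[≠] 0) (𝓝 (g' k' 0)) :=
      (hg' k').continuousAt.tendsto.mono_left nhdsWithin_le_nhds
    refine tendsto_nhds_unique_of_frequently_eq h1 h2 (hκ.mono ?_)
    rintro s ⟨φ, hφ, hφe, hφy⟩
    rw [← hφe]
    simp only [e, map_prod, map_sub, hφ, hφy, eval_C]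
  rw [hk'] at hlim
  by_contra hne
  have hmem : g j (κ j) 0 ∈ S j := by
    refine Finset.mem_erase.2 ⟨hne, Multiset.mem_toFinset.2 (mem_roots'.2 ⟨?_, ?_⟩)⟩
    · exact ((minpoly.monic (Algebra.IsIntegral.isIntegral (y j))).map _).ne_zero
    · rw [IsRoot.def, map_evalRingHom_eval]
      have := (hgs j).self_of_nhds (g j (κ j) 0)
      rw [h0M] at this
      rw [this, Finset.prod_eq_zero (Finset.mem_univ (κ j)) (sub_self _)]
  refine hπe (hlim.symm.trans ?_)
  exact Finset.prod_eq_zero (Finset.mem_univ j) (Finset.prod_eq_zero hmem (sub_self _))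

theorem IsAlgClosed.exists_algebraMap_eq_of_aeval_eq_zero {K S : Type*} [Field K] [IsAlgClosed K]
    [CommRing S] [IsDomain S] [Algebra K S] {f : K[X]} (hf : f ≠ 0) {x : S} (hx : aeval x f = 0) :
    ∃ a : K, algebraMap K S a = x := by
  have hx_int : IsIntegral K x := (show IsAlgebraic K x from ⟨f, hf, hx⟩).isIntegral
  exact minpoly.mem_range_of_degree_eq_one K x
    (IsAlgClosed.degree_eq_one_of_irreducible K (minpoly.irreducible hx_int))

open MvPolynomial in
/-- If `p` is the only common zero of fewer than `n` polynomials on the hyperplane `X o = 0` and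
outside the hypersurface `h = 0`, then a holomorphic arc of common zeros emanates from `p`, on
which `X o` is a power of the parameter. -/
theorem MvPolynomial.exists_analyticAt_arc {σ : Type*} [Finite σ] (o : σ)
    (s : Finset (MvPolynomial σ ℂ)) (hs : s.card < Nat.card σ) {p : σ → ℂ} (hpo : p o = 0)
    (hp : ∀ f ∈ s, eval p f = 0) {h : MvPolynomial σ ℂ} (hh : eval p h ≠ 0)
    (H : ∀ x, x o = 0 → (∀ f ∈ s, eval x f = 0) → eval x h ≠ 0 → x = p) :
    ∃ m : ℕ, 0 < m ∧ ∃ g : σ → ℂ → ℂ, (∀ i, AnalyticAt ℂ (g i) 0) ∧ (∀ i, g i 0 = p i) ∧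
      ∀ᶠ t in 𝓝 (0 : ℂ), g o t = t ^ m ∧ ∀ f ∈ s, eval (fun i => g i t) f = 0 := by
  have hmax : (vanishingIdeal ℂ {p}).IsMaximal :=
    isMaximal_iff_eq_vanishingIdeal_singleton.2 ⟨p, rfl⟩
  have hmem : ∀ f, f ∈ vanishingIdeal ℂ {p} ↔ eval p f = 0 :=
    fun f => mem_vanishingIdeal_singleton_iff p f
  obtain ⟨P, hP, hsP, hlt⟩ := exists_isPrime_lt_vanishingIdeal_singleton p s hs hp
  have huniq : ∀ Q : Ideal (MvPolynomial σ ℂ), Q.IsPrime → P ≤ Q → X o ∈ Q → h ∉ Q →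
      Q = vanishingIdeal ℂ {p} := fun Q hQ hPQ ho hhQ =>
    eq_vanishingIdeal_singleton_of_isPrime hhQ fun x hx =>
      H x (by simpa using hx _ ho) fun f hf => hx f (hPQ (hsP f hf))
  let S := MvPolynomial σ ℂ ⧸ P
  let mk : MvPolynomial σ ℂ →ₐ[ℂ] S := Ideal.Quotient.mkₐ ℂ P
  have hmk : Function.Surjective mk := Ideal.Quotient.mkₐ_surjective ℂ P
  have hmk0 : ∀ f, mk f = 0 ↔ f ∈ P := fun f => Ideal.Quotient.eq_zero_iff_mem
  have hft : Algebra.FiniteType ℂ S := Algebra.FiniteType.of_surjective mk hmk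
  let x₀ : S := mk (X o)
  let alg : Algebra ℂ[X] S := (Polynomial.aeval x₀ : ℂ[X] →ₐ[ℂ] S).toRingHom.toAlgebra
  have hal : ∀ f : ℂ[X], algebraMap ℂ[X] S f = Polynomial.aeval x₀ f := fun _ => rfl
  have htower : IsScalarTower ℂ ℂ[X] S := IsScalarTower.of_algebraMap_eq fun z => by
    rw [hal, Polynomial.algebraMap_eq, Polynomial.aeval_C]
  have hft' : Algebra.FiniteType ℂ[X] S := Algebra.FiniteType.of_restrictScalars_finiteType ℂ _ _
  have hinj : Function.Injective (algebraMap ℂ[X] S) := by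
    rw [injective_iff_map_eq_zero]
    intro f hf
    by_contra hf0
    obtain ⟨a, ha⟩ := IsAlgClosed.exists_algebraMap_eq_of_aeval_eq_zero hf0 hf
    have h1 : X o - C a ∈ P := by
      rw [← hmk0, map_sub, sub_eq_zero]
      exact ha.symm.trans (AlgHom.commutes mk a).symm
    have h2 := (hmem _).1 (hlt.le h1)
    simp only [map_sub, eval_X, eval_C, hpo, zero_sub, neg_eq_zero] at h2
    rw [h2, map_zero, sub_zero] at h1
    exact hlt.ne (huniq P hP le_rfl h1 fun h3 => hh ((hmem _).1 (hlt.le h3)))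
  have hfaith : FaithfulSMul ℂ[X] S := (faithfulSMul_iff_algebraMap_injective _ _).2 hinj
  let π : S →+* ℂ := Ideal.Quotient.lift P (eval p) fun f hf => (hmem f).1 (hlt.le hf)
  have hπ : ∀ f, π (mk f) = eval p f := fun f => Ideal.Quotient.lift_mk P _ _
  have eval_of : ∀ (ψ : S →+* ℂ) (t : ℂ), (∀ f : ℂ[X], ψ (algebraMap ℂ[X] S f) = f.eval t) →
      ∀ f, ψ (mk f) = eval (fun i => ψ (mk (X i))) f := by
    intro ψ t hψ f
    have : ψ.comp mk.toRingHom = eval (fun i => ψ (mk (X i))) := by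
      refine MvPolynomial.ringHom_ext (fun z => ?_) fun i => by simp
      have h1 := hψ (Polynomial.C z)
      rw [hal, Polynomial.aeval_C, Polynomial.eval_C] at h1
      rw [eval_C]
      exact (congrArg ψ (AlgHom.commutes mk z)).trans h1
    exact congr($this f)
  have hπX : ∀ f : ℂ[X], π (algebraMap ℂ[X] S f) = f.eval 0 := by
    intro f
    have : (π.comp (algebraMap ℂ[X] S)) = Polynomial.evalRingHom 0 := by
      refine Polynomial.ringHom_ext (fun z => ?_) ?_
      · rw [RingHom.comp_apply, hal, Polynomial.aeval_C, ← AlgHom.commutes mk, hπ]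
        simp
      · rw [RingHom.comp_apply, hal, Polynomial.aeval_X, hπ]
        simp [hpo]
    exact congr($this f)
  have hqcomap : (RingHom.ker π).comap mk = vanishingIdeal ℂ {p} := by
    ext f
    rw [hmem, Ideal.mem_comap, RingHom.mem_ker, hπ]
  have hprime : (RingHom.ker π).IsPrime := RingHom.ker_isPrime π
  have hZ : Algebra.ZariskisMainProperty ℂ[X] (RingHom.ker π) := by
    refine .of_isolated (h := mk h) (by rwa [RingHom.mem_ker, hπ]) fun Q hQ hQc hhQ => ?_
    refine Ideal.comap_injective_of_surjective mk hmk ?_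
    rw [hqcomap]
    refine huniq _ (hQ.comap mk) (fun f hf => ?_) ?_ hhQ
    · rw [Ideal.mem_comap, (hmk0 f).2 hf]
      exact Q.zero_mem
    · have h1 : Polynomial.X ∈ Q.comap (algebraMap ℂ[X] S) := by
        rw [hQc, Ideal.mem_comap, RingHom.mem_ker, hπX, Polynomial.eval_X]
      rwa [Ideal.mem_comap, hal, Polynomial.aeval_X] at h1
  obtain ⟨r, hr, hbij⟩ := hZ
  have hsurj := Localization.awayMap_surjective_iff.1 hbij.2
  choose b k hbk using fun i => hsurj (mk (X i))
  let π' : integralClosure ℂ[X] S →+* ℂ := π.comp (integralClosure ℂ[X] S).val.toRingHom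
  obtain ⟨m, hm, g, hg, hg0, hfreq⟩ := exists_analyticAt_branch π' hπX
    (fun j : Option σ => j.elim r b)
  have hgr : g none 0 ≠ 0 := by
    rw [hg0]
    exact hr
  have hgi : ∀ i, AnalyticAt ℂ (fun t => g (some i) t / g none t ^ k i) 0 := fun i =>
    (hg _).div ((hg _).pow _) (pow_ne_zero _ hgr)
  refine ⟨m, hm, fun i t => g (some i) t / g none t ^ k i, hgi, fun i => ?_, ?_⟩
  · rw [div_eq_iff (pow_ne_zero _ hgr), hg0, hg0]
    have := congrArg π (hbk i)
    rw [map_mul, map_pow, hπ, eval_X] at this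
    rw [mul_comm]
    exact this
  have hne : ∀ᶠ t in 𝓝[≠] (0 : ℂ), g none t ≠ 0 :=
    nhdsWithin_le_nhds ((hg none).continuousAt.eventually_ne hgr)
  have hfreq' : ∃ᶠ t in 𝓝[≠] (0 : ℂ), (g (some o) t / g none t ^ k o = t ^ m) ∧
      ∀ f ∈ s, eval (fun i => g (some i) t / g none t ^ k i) f = 0 := by
    refine (hfreq.and_eventually hne).mono ?_
    rintro t ⟨⟨φ, hφ, hφj⟩, hnt⟩
    have hφr : φ r = g none t := hφj none
    obtain ⟨ψ, hψ⟩ := RingHom.exists_extend_of_bijective_awayMap _ hbij φ (by rwa [hφr])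
    have hψb : ∀ c : integralClosure ℂ[X] S, ψ c.1 = φ c := fun c => congr($hψ c)
    have hψX : ∀ i, ψ (mk (X i)) = g (some i) t / g none t ^ k i := by
      intro i
      rw [eq_div_iff (pow_ne_zero _ hnt), ← hφj (some i), ← hφr, mul_comm]
      have := congrArg ψ (hbk i)
      rw [map_mul, map_pow] at this
      rw [← hψb r]
      exact this.symm.trans (hψb (b i))
    have hψp : ∀ f : ℂ[X], ψ (algebraMap ℂ[X] S f) = f.eval (t ^ m) := fun f => by
      rw [← hφ f]
      exact hψb (algebraMap ℂ[X] _ f)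
    simp only [← hψX]
    refine ⟨?_, fun f hf => ?_⟩
    · have h1 := hψp Polynomial.X
      rwa [hal, Polynomial.aeval_X, Polynomial.eval_X] at h1
    · rw [← eval_of ψ _ hψp, (hmk0 f).2 (hsP f hf), map_zero]
  refine Eventually.and ?_ ((Finset.eventually_all s).2 fun f hf => ?_)
  · exact ((hgi o).frequently_eq_iff_eventually_eq (analyticAt_id.pow m)).1
      (hfreq'.mono fun t ht => ht.1)
  · have h1 : AnalyticAt ℂ (fun t => eval (fun i => g (some i) t / g none t ^ k i) f) 0 :=
      AnalyticAt.aeval_mvPolynomial hgi f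
    exact h1.frequently_zero_iff_eventually_zero.1 (hfreq'.mono fun t ht => ht.2 f hf)

open MvPolynomial in
theorem MvPolynomial.exists_eval_ne_zero_and_eval_eq_zero {σ K : Type*} [Field K] {F : Set (σ → K)}
    (hF : F.Finite) (p : σ → K) :
    ∃ h : MvPolynomial σ K, eval p h ≠ 0 ∧ ∀ x ∈ F, eval x h ≠ 0 → x = p := by
  induction F, hF using Set.Finite.induction_on with
  | empty => exact ⟨1, by simp, by simp⟩
  | @insert a F _ _ ih =>
    obtain ⟨h, hp, hF⟩ := ih
    by_cases hap : a = p
    · exact ⟨h, hp, by rintro x (rfl | hx) hxh; exacts [hap, hF x hx hxh]⟩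
    · obtain ⟨i, hi⟩ := Function.ne_iff.1 hap
      refine ⟨h * (X i - C (a i)), by simpa [hp, sub_eq_zero] using hi.symm, ?_⟩
      rintro x (rfl | hx) hxh
      · simp at hxh
      · exact hF x hx fun h0 => hxh (by simp [h0])

/-- The relation lattice of a tuple of nonzero numbers `x` and `y`. -/
def relationSubmodule {n : ℕ} (x y : Fin n → ℂ) (hx : ∀ i, x i ≠ 0) (hy : ∀ i, y i ≠ 0) :
    Submodule ℤ (GlueVec n) :=
  AddSubgroup.toIntSubmodule
    { carrier := {v | (∏ i, x i ^ v.1 i) * (∏ i, y i ^ v.2.1 i) = (-1 : ℂ) ^ v.2.2}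
      zero_mem' := by simp
      add_mem' := fun {v w} hv hw => by
        simp only [Set.mem_ofPred_eq, Prod.fst_add, Prod.snd_add, Pi.add_apply,
          zpow_add₀ (hx _), zpow_add₀ (hy _), Finset.prod_mul_distrib,
          zpow_add₀ (neg_ne_zero.2 (one_ne_zero' ℂ))] at hv hw ⊢
        rw [← hv, ← hw]
        ring
      neg_mem' := fun {v} hv => by
        simp only [Set.mem_ofPred_eq, Prod.fst_neg, Prod.snd_neg, Pi.neg_apply, zpow_neg,
          Finset.prod_inv_distrib] at hv ⊢
        rw [← hv, mul_inv] }

theorem mem_relationSubmodule {n : ℕ} {x y : Fin n → ℂ} {hx : ∀ i, x i ≠ 0} {hy : ∀ i, y i ≠ 0}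
    {v : GlueVec n} : v ∈ relationSubmodule x y hx hy ↔
      (∏ i, x i ^ v.1 i) * (∏ i, y i ^ v.2.1 i) = (-1 : ℂ) ^ v.2.2 := Iff.rfl

theorem prod_zpow_eq_div {ι K : Type*} [Fintype ι] [Field K] {x : ι → K} (hx : ∀ i, x i ≠ 0)
    (a : ι → ℤ) : ∏ i, x i ^ a i = (∏ i, x i ^ (a i).toNat) / ∏ i, x i ^ (-a i).toNat := by
  rw [← Finset.prod_div_distrib]
  refine Finset.prod_congr rfl fun i _ => ?_
  conv_lhs => rw [← Int.toNat_sub_toNat_neg (a i), zpow_sub₀ (hx i), zpow_natCast, zpow_natCast]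

/-- The relation with exponent vector `v` between the entries of two families, cleared of
denominators. -/
noncomputable def relationDiff {R : Type*} [CommRing R] {n : ℕ} (x y : Fin n → R)
    (v : GlueVec n) : R :=
  (∏ i, x i ^ (v.1 i).toNat) * (∏ i, y i ^ (v.2.1 i).toNat) -
    (((-1 : ℤˣ) ^ v.2.2 : ℤˣ) : ℤ) *
      ((∏ i, x i ^ (-v.1 i).toNat) * (∏ i, y i ^ (-v.2.1 i).toNat))

theorem map_relationDiff {R R' : Type*} [CommRing R] [CommRing R'] (φ : R →+* R') {n : ℕ}
    (x y : Fin n → R) (v : GlueVec n) :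
    φ (relationDiff x y v) = relationDiff (fun i => φ (x i)) (fun i => φ (y i)) v := by
  simp [relationDiff]

theorem relationDiff_eq_zero_iff {n : ℕ} {x y : Fin n → ℂ} (hx : ∀ i, x i ≠ 0)
    (hy : ∀ i, y i ≠ 0) (v : GlueVec n) :
    relationDiff x y v = 0 ↔ v ∈ relationSubmodule x y hx hy := by
  have h1 : ((((-1 : ℤˣ) ^ v.2.2 : ℤˣ) : ℤ) : ℂ) = (-1 : ℂ) ^ v.2.2 := by
    rcases Int.even_or_odd v.2.2 with h | h
    · simp [h.neg_one_zpow]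
    · simp [h.neg_one_zpow]
  rw [mem_relationSubmodule, prod_zpow_eq_div hx, prod_zpow_eq_div hy, div_mul_div_comm,
    div_eq_iff (mul_ne_zero (Finset.prod_ne_zero_iff.2 fun i _ => pow_ne_zero _ (hx i))
      (Finset.prod_ne_zero_iff.2 fun i _ => pow_ne_zero _ (hy i))), relationDiff, sub_eq_zero, h1]

theorem prod_zpow_pow_mul {n : ℕ} {t : ℂ} (ht : t ≠ 0) (u : Fin n → ℂ) {d : Fin n → ℕ}
    {a : Fin n → ℤ} (h : ∑ i, a i * (d i : ℤ) = 0) :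
    ∏ i, (t ^ d i * u i) ^ a i = ∏ i, u i ^ a i := by
  have h1 : ∏ i, (t ^ d i) ^ a i = 1 := by
    have h2 : ∀ i, (t ^ d i) ^ a i = t ^ (a i * (d i : ℤ)) := fun i => by
      rw [← zpow_natCast, ← zpow_mul, mul_comm]
    have h3 : ∀ s : Finset (Fin n), ∏ i ∈ s, t ^ (a i * (d i : ℤ)) =
        t ^ ∑ i ∈ s, a i * (d i : ℤ) := by
      intro s
      induction s using Finset.cons_induction with
      | empty => simp
      | cons i s hi ih => rw [Finset.prod_cons, Finset.sum_cons, zpow_add₀ ht, ih]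
    simp_rw [h2]
    rw [h3, h, zpow_zero]
  simp_rw [mul_zpow]
  rw [Finset.prod_mul_distrib, h1, one_mul]

theorem prod_subtype_val_ne_zero {n : ℕ} (hn : 0 < n) {f : Fin n → ℂ} (h : f ⟨0, hn⟩ = 1) :
    ∏ i : {i : Fin n // (i : ℕ) ≠ 0}, f i = ∏ i, f i := by
  rw [← Fintype.prod_subtype_mul_prod_subtype (fun i : Fin n => (i : ℕ) ≠ 0) f,
    Finset.prod_eq_one (s := Finset.univ (α := {i : Fin n // ¬ (i : ℕ) ≠ 0})), mul_one]
  rintro ⟨i, hi⟩ -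
  have hi0 : i = ⟨0, hn⟩ := Fin.ext (not_not.1 hi)
  exact (congrArg f hi0).trans h

/-- The first-order system is the fibre at `t = 0` of the family `t ↦ (t^{dᵢ} uᵢ)`, normalized by
`u₁ = 1`. -/
theorem mem_firstOrderSys_iff {n : ℕ} (hn : 0 < n) {Λ : Submodule ℤ (GlueVec n)} {d : Fin n → ℕ}
    (hd1 : 0 < d ⟨0, hn⟩) {u : Fin n → ℂ} (hu : u ⟨0, hn⟩ = 1) :
    (fun i : {i : Fin n // (i : ℕ) ≠ 0} => u i) ∈ FirstOrderSys n Λ d ↔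
      ∃ (hx : ∀ i, u i ≠ 0) (hy : ∀ i, 1 - 0 ^ d i * u i ≠ 0),
        Λ ≤ relationSubmodule u (fun i => 1 - 0 ^ d i * u i) hx hy := by
  have hne : ∀ i : Fin n, (i : ℕ) = 0 → i = ⟨0, hn⟩ := fun i hi => Fin.ext hi
  have h1 : (∀ i : {i : Fin n // (i : ℕ) ≠ 0}, u i ≠ 0) ↔ ∀ i, u i ≠ 0 := by
    refine ⟨fun h i => ?_, fun h i => h i⟩
    by_cases hi : (i : ℕ) = 0
    · rw [hne i hi, hu]; exact one_ne_zero
    · exact h ⟨i, hi⟩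
  have h2 : (∀ i : {i : Fin n // (i : ℕ) ≠ 0}, d i.1 = 0 → u i ≠ 1) ↔
      ∀ i, 1 - 0 ^ d i * u i ≠ 0 := by
    refine ⟨fun h i => ?_, fun h i hi hui => h i ?_⟩
    · by_cases hdi : d i = 0
      · have hi : (i : ℕ) ≠ 0 := fun h0 => by rw [hne i h0] at hdi; omega
        have := h ⟨i, hi⟩ hdi
        rw [hdi, pow_zero, one_mul, sub_ne_zero]
        exact this.symm
      · simp [hdi]
    · simp [hi, hui]
  have h3 : ∀ v : GlueVec n, (∏ i : {i : Fin n // (i : ℕ) ≠ 0}, u i ^ v.1 i.1) *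
      (∏ i ∈ Finset.univ.filter (fun i : {i : Fin n // (i : ℕ) ≠ 0} => d i.1 = 0),
        (1 - u i) ^ v.2.1 i.1) =
      (∏ i, u i ^ v.1 i) * ∏ i, (1 - 0 ^ d i * u i) ^ v.2.1 i := by
    intro v
    rw [prod_subtype_val_ne_zero hn (f := fun i => u i ^ v.1 i) (by simp [hu]),
      Finset.prod_filter, ← prod_subtype_val_ne_zero hn
        (f := fun i => (1 - 0 ^ d i * u i) ^ v.2.1 i) (by simp [hd1.ne'])]
    congr 1
    refine Finset.prod_congr rfl fun i _ => ?_
    split_ifs with h <;> simp [h]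
  simp only [FirstOrderSys, Set.mem_ofPred_eq, h3, h1, h2]
  exact ⟨fun h => ⟨h.1, h.2.1, fun v hv => h.2.2 v hv⟩, fun ⟨hx, hy, h⟩ => ⟨hx, hy, fun v hv => h hv⟩⟩

end

/-- Lemma 4.5: if `Λ` has rank at most `n-1`, `d` is a degeneration vector with `d₁ > 0`,
and the first-order system `W₀(Λ,d)` is nonempty and finite, then some positive integer
multiple of `d` is genuine. -/
theorem firstOrderSys_finite_implies_multiple_genuine (n : ℕ) (hn : 0 < n)
    (Λ : Submodule ℤ (GlueVec n)) (hΛrank : Module.finrank ℤ Λ ≤ n - 1)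
    (d : Fin n → ℕ) (hd : IsDegVec n Λ d) (hd1 : 0 < d ⟨0, hn⟩)
    (hne : (FirstOrderSys n Λ d).Nonempty) (hfin : (FirstOrderSys n Λ d).Finite) :
    ∃ m : ℕ, 0 < m ∧ IsGenuine n Λ (fun i => m * d i) := by
  classical
  obtain ⟨β, hβ⟩ := hne
  set o : Fin n := ⟨0, hn⟩ with ho
  have hne0 : ∀ i : Fin n, (i : ℕ) ≠ 0 ↔ i ≠ o := fun i => by
    rw [ne_eq, ne_eq, Fin.ext_iff]
  let ext : ({i : Fin n // (i : ℕ) ≠ 0} → ℂ) → Fin n → ℂ := fun γ i =>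
    if h : (i : ℕ) ≠ 0 then γ ⟨i, h⟩ else 0
  let N : (Fin n → ℂ) → Fin n → ℂ := fun x i => if i = o then 1 else x i
  have hNo : ∀ x, N x o = 1 := fun x => by simp [N]
  have hext_o : ∀ γ, ext γ o = 0 := fun γ => by simp [ext, ho]
  have hres : ∀ x : Fin n → ℂ, (fun i : {i : Fin n // (i : ℕ) ≠ 0} => N x i) =
      fun i : {i : Fin n // (i : ℕ) ≠ 0} => x i := by
    intro x
    funext i
    simp only [N]
    rw [if_neg ((hne0 _).1 i.2)]
  have hext_res : ∀ x : Fin n → ℂ, x o = 0 →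
      ext (fun i : {i : Fin n // (i : ℕ) ≠ 0} => x i) = x := by
    intro x hx
    funext i
    by_cases hi : (i : ℕ) = 0
    · have : i = o := Fin.ext hi
      rw [this, hx]
      exact hext_o fun i => x i
    · simp [ext, hi]
  have hres_ext : ∀ γ, (fun i : {i : Fin n // (i : ℕ) ≠ 0} => ext γ i) = γ := by
    intro γ
    funext i
    simp [ext, i.2]
  let uP : Fin n → MvPolynomial (Fin n) ℂ := fun i => if i = o then 1 else MvPolynomial.X i
  let wP : Fin n → MvPolynomial (Fin n) ℂ := fun i => 1 - MvPolynomial.X o ^ d i * uP i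
  have hu : ∀ x i, MvPolynomial.eval x (uP i) = N x i := fun x i => by
    simp only [uP, N]
    split_ifs <;> simp
  have hw : ∀ x i, MvPolynomial.eval x (wP i) = 1 - x o ^ d i * N x i := fun x i => by
    simp [wP, hu]
  let b := Module.finBasis ℤ Λ
  let s : Finset (MvPolynomial (Fin n) ℂ) :=
    Finset.univ.image fun j => relationDiff uP wP (b j : GlueVec n)
  have hs : s.card < Nat.card (Fin n) := by
    have h1 : s.card ≤ Module.finrank ℤ Λ := by
      simpa using Finset.card_image_le (s := Finset.univ)
        (f := fun j => relationDiff uP wP (b j : GlueVec n))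
    rw [Nat.card_fin]
    omega
  have hrel : ∀ (x : Fin n → ℂ) (hx : ∀ i, N x i ≠ 0) (hy : ∀ i, 1 - x o ^ d i * N x i ≠ 0),
      (∀ f ∈ s, MvPolynomial.eval x f = 0) ↔
        Λ ≤ relationSubmodule (N x) (fun i => 1 - x o ^ d i * N x i) hx hy := by
    intro x hx hy
    have h1 : ∀ v, MvPolynomial.eval x (relationDiff uP wP v) = 0 ↔
        v ∈ relationSubmodule (N x) (fun i => 1 - x o ^ d i * N x i) hx hy := fun v => by
      rw [map_relationDiff, ← relationDiff_eq_zero_iff]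
      simp only [hu, hw]
    simp only [s, Finset.mem_image, Finset.mem_univ, true_and, forall_exists_index,
      forall_apply_eq_imp_iff, h1]
    refine ⟨fun h v hv => ?_, fun h j => h (b j).2⟩
    have h2 : (relationSubmodule (N x) (fun i => 1 - x o ^ d i * N x i) hx hy).comap
        Λ.subtype = ⊤ := by
      rw [eq_top_iff, ← b.span_eq, Submodule.span_le]
      rintro _ ⟨j, rfl⟩
      exact h j
    exact (h2 ▸ Submodule.mem_top : (⟨v, hv⟩ : Λ) ∈ Submodule.comap Λ.subtype
      (relationSubmodule (N x) (fun i => 1 - x o ^ d i * N x i) hx hy))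
  have hfos : ∀ x : Fin n → ℂ, x o = 0 → ((fun i : {i : Fin n // (i : ℕ) ≠ 0} => x i) ∈
      FirstOrderSys n Λ d ↔ ∃ (hx : ∀ i, N x i ≠ 0) (hy : ∀ i, 1 - x o ^ d i * N x i ≠ 0),
        Λ ≤ relationSubmodule (N x) (fun i => 1 - x o ^ d i * N x i) hx hy) := by
    intro x hx
    rw [← hres x, mem_firstOrderSys_iff hn hd1 (hNo x), hx]
  set p := ext β with hp
  have hpo : p o = 0 := hext_o β
  obtain ⟨hpx, hpy, hpΛ⟩ := (hfos p hpo).1 (by rw [hp, hres_ext]; exact hβ)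
  obtain ⟨h', hh'p, hh'⟩ :=
    MvPolynomial.exists_eval_ne_zero_and_eval_eq_zero (hfin.image ext) p
  obtain ⟨m, hm, g, hga, hg0, hg⟩ := MvPolynomial.exists_analyticAt_arc o s hs hpo
    ((hrel p hpx hpy).2 hpΛ) (h := (∏ i, uP i) * (∏ i, wP i) * h')
    (by
      simp only [map_mul, map_prod, hu, hw]
      exact mul_ne_zero (mul_ne_zero (Finset.prod_ne_zero_iff.2 fun i _ => hpx i)
        (Finset.prod_ne_zero_iff.2 fun i _ => hpy i)) hh'p)
    (by
      intro x hxo hxs hxh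
      simp only [map_mul, map_prod, hu, hw] at hxh
      have hx : ∀ i, N x i ≠ 0 := fun i =>
        Finset.prod_ne_zero_iff.1 (left_ne_zero_of_mul (left_ne_zero_of_mul hxh)) i
          (Finset.mem_univ i)
      have hy : ∀ i, 1 - x o ^ d i * N x i ≠ 0 := fun i =>
        Finset.prod_ne_zero_iff.1 (right_ne_zero_of_mul (left_ne_zero_of_mul hxh)) i
          (Finset.mem_univ i)
      exact hh' x ⟨_, (hfos x hxo).2 ⟨hx, hy, (hrel x hx hy).1 hxs⟩, hext_res x hxo⟩
        (right_ne_zero_of_mul hxh))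
  let u : Fin n → ℂ → ℂ := fun i t => N (fun j => g j t) i
  have hua : ∀ i, AnalyticAt ℂ (u i) 0 := by
    intro i
    by_cases hi : i = o
    · have : u i = fun _ => 1 := by funext t; simp [u, N, hi]
      rw [this]
      exact analyticAt_const
    · have : u i = g i := by funext t; simp [u, N, hi]
      rw [this]
      exact hga i
  have hu0 : ∀ i, u i 0 = N p i := fun i => by simp only [u, hg0]
  have hgo : g o 0 = 0 := (hg0 o).trans hpo
  have hwa : ∀ i, AnalyticAt ℂ (fun t => 1 - g o t ^ d i * u i t) 0 := fun i =>
    analyticAt_const.sub (((hga o).pow _).mul (hua i))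
  have hev : ∀ᶠ t in nhds (0 : ℂ), (∀ i, AnalyticAt ℂ (u i) t) ∧ (∀ i, u i t ≠ 0) ∧
      (∀ i, 1 - g o t ^ d i * u i t ≠ 0) ∧ g o t = t ^ m ∧
      ∀ f ∈ s, MvPolynomial.eval (fun i => g i t) f = 0 := by
    refine (Filter.eventually_all.2 fun i => (hua i).eventually_analyticAt).and
      ((Filter.eventually_all.2 fun i => (hua i).continuousAt.eventually_ne ?_).and
      ((Filter.eventually_all.2 fun i => (hwa i).continuousAt.eventually_ne ?_).and hg))
    · rw [hu0]
      exact hpx i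
    · simp only [hu0, hg0]
      exact hpy i
  obtain ⟨ε, hε, hball⟩ := Metric.eventually_nhds_iff_ball.1 hev
  refine ⟨m, hm, ε, hε, u, fun i t ht => ?_, fun i => ?_, fun i hi => ?_, fun t ht0 htε => ?_⟩
  · exact ((hball t ht).1 i).differentiableAt.differentiableWithinAt
  · rw [hu0]
    exact hpx i
  · have hdi : d i = 0 := (mul_eq_zero.1 hi).resolve_left hm.ne'
    have := hpy i
    rw [hdi, pow_zero, one_mul, sub_ne_zero] at this
    rw [hu0]
    exact this.symm
  · obtain ⟨-, hx, hy, hgt, hst⟩ := hball t (by simpa using htε)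
    have ht : t ≠ 0 := norm_pos_iff.1 ht0
    have hz : ∀ i, g o t ^ d i = t ^ (m * d i) := fun i => by rw [hgt, pow_mul]
    have hΛ := (hrel (fun i => g i t) hx hy).1 hst
    refine ⟨fun i => ⟨mul_ne_zero (pow_ne_zero _ ht) (hx i), fun h1 => hy i ?_⟩, fun v hv => ?_⟩
    · rw [hz]
      exact sub_eq_zero.2 h1.symm
    · have h1 := mem_relationSubmodule.1 (hΛ hv)
      simp only [hz] at h1
      rw [prod_zpow_pow_mul ht]
      · exact h1
      · have h2 := hd.2 v hv
        push_cast
        rw [← mul_zero (m : ℤ), ← h2, Finset.mul_sum]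
        exact Finset.sum_congr rfl fun i _ => by ring
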